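/- arXiv:1905.08998 — 2 statements merged into one kernel-verified Lean document; each statement's English description precedes it below -/
import Mathlib

section
/- Suppose G is bipartite. If w ∈ 𝒲^a_{n−2} solves the measurement system for data z lying in the column span of 𝓑, then w is the unique solution of the measurement system for z in 𝒲_{n−2}. -/
open Matrix

/-- Head incidence matrix `B₊` for the orientation with head map `hd`. -/
def Bplus {n : ℕ} (G : SimpleGraph (Fin n)) (hd : G.edgeSet → Fin n) :
    Matrix G.edgeSet (Fin n) ℝ :=
  Matrix.of fun e i => if i = hd e then (1 : ℝ) else 0

/-- Tail incidence matrix `B₋` for the orientation with tail map `tl`. -/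
def Bminus {n : ℕ} (G : SimpleGraph (Fin n)) (tl : G.edgeSet → Fin n) :
    Matrix G.edgeSet (Fin n) ℝ :=
  Matrix.of fun e i => if i = tl e then (-1 : ℝ) else 0

/-- `hd, tl` form an orientation of `G`: the head and tail of each edge are its two
(distinct) endpoints. -/
def IsOrientation {n : ℕ} (G : SimpleGraph (Fin n)) (hd tl : G.edgeSet → Fin n) : Prop :=
  ∀ e : G.edgeSet, hd e ≠ tl e ∧ (e : Sym2 (Fin n)) = s(hd e, tl e)

/-- `w̄` solves the measurement system `ζ = -B x̄ + B₊ w̄`, `η = B x̄ - B₋ w̄`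
for the data `z = (ζ, η)`, where `B = B₊ + B₋`. -/
def Solves {n : ℕ} (G : SimpleGraph (Fin n)) (hd tl : G.edgeSet → Fin n)
    (ζ η : G.edgeSet → ℝ) (wbar : Fin n → ℝ) : Prop :=
  ∃ xbar : Fin n → ℝ,
    ζ = -((Bplus G hd + Bminus G tl) *ᵥ xbar) + Bplus G hd *ᵥ wbar ∧
    η = (Bplus G hd + Bminus G tl) *ᵥ xbar - Bminus G tl *ᵥ wbar

/-- `G` is bipartite. -/
def IsBipartite {n : ℕ} (G : SimpleGraph (Fin n)) : Prop :=
  ∃ Vp Vm : Set (Fin n), Disjoint Vp Vm ∧ Vp ∪ Vm = Set.univ ∧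
    ∀ ⦃u v : Fin n⦄, G.Adj u v → (u ∈ Vp ∧ v ∈ Vm) ∨ (u ∈ Vm ∧ v ∈ Vp)

/-- The number of nonzero entries of a vector (its `ℓ₀`-"norm"). -/
noncomputable def zeroNorm {n : ℕ} (w : Fin n → ℝ) : ℕ := Set.ncard {i | w i ≠ 0}

/-- The difference of two solutions has opposite values at the two ends of each edge. -/
lemma Solves.sub_hd_add_sub_tl {n : ℕ} {G : SimpleGraph (Fin n)} {hd tl : G.edgeSet → Fin n}
    {ζ η : G.edgeSet → ℝ} {w w' : Fin n → ℝ} (hw : Solves G hd tl ζ η w)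
    (hw' : Solves G hd tl ζ η w') (e : G.edgeSet) :
    (w' (hd e) - w (hd e)) + (w' (tl e) - w (tl e)) = 0 := by
  obtain ⟨x, hζ, hη⟩ := hw
  obtain ⟨x', hζ', hη'⟩ := hw'
  have h₁ := congrFun hζ e
  have h₂ := congrFun hη e
  have h₃ := congrFun hζ' e
  have h₄ := congrFun hη' e
  have hplus (v : Fin n → ℝ) : (Bplus G hd *ᵥ v) e = v (hd e) := by
    simp [Bplus, Matrix.mulVec, dotProduct]
  have hminus (v : Fin n → ℝ) : (Bminus G tl *ᵥ v) e = -v (tl e) := by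
    simp [Bminus, Matrix.mulVec, dotProduct]
  simp only [Matrix.add_mulVec, Pi.add_apply, Pi.sub_apply, Pi.neg_apply, hplus, hminus]
    at h₁ h₂ h₃ h₄
  linarith

/-- The difference of two solutions on a connected graph has constant absolute value. -/
lemma Solves.abs_sub_eq {n : ℕ} {G : SimpleGraph (Fin n)} (hconn : G.Connected)
    {hd tl : G.edgeSet → Fin n} (horient : IsOrientation G hd tl)
    {ζ η : G.edgeSet → ℝ} {w w' : Fin n → ℝ} (hw : Solves G hd tl ζ η w)
    (hw' : Solves G hd tl ζ η w') (i j : Fin n) : |w' i - w i| = |w' j - w j| := by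
  have hadj (u v : Fin n) (huv : G.Adj u v) : |w' u - w u| = |w' v - w v| := by
    have hsum := hw.sub_hd_add_sub_tl hw' ⟨s(u, v), huv⟩
    obtain ⟨-, he⟩ := horient ⟨s(u, v), huv⟩
    rcases Sym2.eq_iff.mp he with ⟨hu, hv⟩ | ⟨hu, hv⟩ <;> rw [← hu, ← hv] at hsum
    · rw [eq_neg_of_add_eq_zero_left hsum, abs_neg]
    · rw [eq_neg_of_add_eq_zero_right hsum, abs_neg]
  obtain ⟨p⟩ := hconn.preconnected i j
  induction p with
  | nil => rfl
  | cons h _ ih => exact (hadj _ _ h).trans ih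

/-- A vector with at most `n - 2` nonzero entries vanishes at two distinct indices. -/
lemma exists_ne_zeros_of_zeroNorm_le {n : ℕ} (hn : 2 ≤ n) {w : Fin n → ℝ}
    (hw : zeroNorm w ≤ n - 2) : ∃ i j : Fin n, i ≠ j ∧ w i = 0 ∧ w j = 0 := by
  have hcard := Set.ncard_add_ncard_compl {i : Fin n | w i ≠ 0}
  rw [Nat.card_fin] at hcard
  have hlt : 1 < ({i : Fin n | w i ≠ 0}ᶜ).ncard := by
    unfold zeroNorm at hw
    omega
  obtain ⟨i, hi, j, hj, hij⟩ := (Set.one_lt_ncard_iff_nontrivial).mp hlt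
  exact ⟨i, j, hij, by simpa using hi, by simpa using hj⟩

/-- for bipartite `G`, a solution `w ∈ 𝒲ᵃ_{n-2}` (at most `n-2` nonzero
entries, with pairwise distinct absolute values) of the measurement system is the unique
solution in `𝒲_{n-2}`. -/
theorem stmt14 {n : ℕ} (hn : 2 ≤ n) (G : SimpleGraph (Fin n)) (hconn : G.Connected)
    (hbip : IsBipartite G)
    (hd tl : G.edgeSet → Fin n) (horient : IsOrientation G hd tl)
    (ζ η : G.edgeSet → ℝ) (w : Fin n → ℝ)
    (hwsp : zeroNorm w ≤ n - 2)
    (hwhet : ∀ i j : Fin n, i ≠ j → w i ≠ 0 → w j ≠ 0 → |w i| ≠ |w j|)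
    (hw : Solves G hd tl ζ η w) :
    ∀ w' : Fin n → ℝ, zeroNorm w' ≤ n - 2 → Solves G hd tl ζ η w' → w' = w := by
  intro w' hwsp' hw'
  obtain ⟨i, j, hij, hi, hj⟩ := exists_ne_zeros_of_zeroNorm_le hn hwsp'
  have habs := hw.abs_sub_eq hconn horient hw'
  have hwi : w i = 0 := by
    by_contra hwi
    have hij_abs : |w i| = |w j| := by simpa [hi, hj] using habs i j
    have hwj : w j ≠ 0 := by
      rw [← abs_pos, ← hij_abs]
      exact abs_pos.mpr hwi
    exact hwhet i j hij hwi hwj hij_abs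
  funext k
  have hk : |w' k - w k| = 0 := by simpa [hi, hwi] using habs k i
  exact sub_eq_zero.mp (abs_eq_zero.mp hk)
end

section
/- Suppose G is bipartite and let s be a positive integer. Then the signless edge–node incidence matrix R satisfies the nullspace property of order s if and only if 2s < n; in particular, R satisfies the nullspace property of order ⌊(n−1)/2⌋. -/
open Matrix

/-- The signless edge–node incidence matrix of a simple graph `G`. -/
noncomputable def signlessInc (n : ℕ) (G : SimpleGraph (Fin n)) :
    Matrix G.edgeSet (Fin n) ℝ :=
  Matrix.of fun e i => if i ∈ (e : Sym2 (Fin n)) then (1 : ℝ) else 0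

/-- A matrix `F` (with columns indexed by `Fin n`) satisfies the nullspace property of
order `s` if for every nonzero `v` with `F v = 0` and every index set `S` with
`|S| ≤ s`, `Σ_{i∈S} |v i| < Σ_{j∉S} |v j|`. -/
def NullspaceProperty {m : Type*} {n : ℕ} (F : Matrix m (Fin n) ℝ) (s : ℕ) : Prop :=
  ∀ v : Fin n → ℝ, v ≠ 0 → F *ᵥ v = 0 →
    ∀ S : Finset (Fin n), S.card ≤ s →
      ∑ i ∈ S, |v i| < ∑ j ∈ Sᶜ, |v j|

/-- The row of the signless incidence matrix at the edge `uv` sends `x` to `x u + x v`. -/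
lemma signlessInc_mulVec_apply {n : ℕ} {G : SimpleGraph (Fin n)} {u v : Fin n}
    (h : G.Adj u v) (x : Fin n → ℝ) :
    (signlessInc n G *ᵥ x) ⟨s(u, v), h⟩ = x u + x v := by
  have hsum : ∀ i : Fin n, signlessInc n G ⟨s(u, v), h⟩ i * x i =
      (if i = u then x i else 0) + (if i = v then x i else 0) := by
    intro i
    have huv := h.ne
    by_cases hu : i = u
    · subst hu
      simp [signlessInc, huv]
    · by_cases hv : i = v <;> simp [signlessInc, hu, hv, huv.symm]
  simp [mulVec, dotProduct, hsum, Finset.sum_add_distrib]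

lemma signlessInc_mulVec_eq_zero_iff {n : ℕ} {G : SimpleGraph (Fin n)} {x : Fin n → ℝ} :
    signlessInc n G *ᵥ x = 0 ↔ ∀ u v, G.Adj u v → x u + x v = 0 := by
  constructor
  · intro hx u v h
    rw [← signlessInc_mulVec_apply h x, hx, Pi.zero_apply]
  · intro hx
    ext ⟨e, he⟩
    induction e using Sym2.ind with
    | _ u v =>
      rw [Pi.zero_apply, ← hx u v he]
      exact signlessInc_mulVec_apply he x

/-- On a connected graph, vectors in the kernel of the signless incidence matrix have entries
of constant absolute value. -/
lemma abs_eq_of_signlessInc_mulVec_eq_zero {n : ℕ} {G : SimpleGraph (Fin n)}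
    (hconn : G.Connected) {x : Fin n → ℝ} (hx : signlessInc n G *ᵥ x = 0) (u v : Fin n) :
    |x u| = |x v| := by
  rw [signlessInc_mulVec_eq_zero_iff] at hx
  obtain ⟨p⟩ := hconn.preconnected u v
  induction p with
  | nil => rfl
  | cons h _ ih => rw [← ih, eq_neg_of_add_eq_zero_left (hx _ _ h), abs_neg]

/-- On a bipartite graph, the kernel of the signless incidence matrix contains a sign vector. -/
lemma IsBipartite.exists_abs_eq_one {n : ℕ} {G : SimpleGraph (Fin n)} (hbip : IsBipartite G) :
    ∃ x : Fin n → ℝ, signlessInc n G *ᵥ x = 0 ∧ ∀ i, |x i| = 1 := by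
  classical
  obtain ⟨Vp, Vm, hdisj, -, hadj⟩ := hbip
  refine ⟨fun i => if i ∈ Vp then 1 else -1, ?_, fun i => ?_⟩
  · rw [signlessInc_mulVec_eq_zero_iff]
    intro u v h
    obtain ⟨hu, hv⟩ | ⟨hu, hv⟩ := hadj h
    · simp [hu, Set.disjoint_right.mp hdisj hv]
    · simp [hv, Set.disjoint_right.mp hdisj hu]
  · dsimp only
    split_ifs <;> simp

lemma nullspaceProperty_signlessInc_of_two_mul_lt {n : ℕ} {G : SimpleGraph (Fin n)}
    (hconn : G.Connected) {s : ℕ} (hs : 2 * s < n) :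
    NullspaceProperty (signlessInc n G) s := by
  intro x hx0 hx S hS
  obtain ⟨k, hk⟩ := Function.ne_iff.mp hx0
  have habs : ∀ i, |x i| = |x k| :=
    fun i => abs_eq_of_signlessInc_mulVec_eq_zero hconn hx i k
  have hcard : S.card < Sᶜ.card := by
    rw [Finset.card_compl, Fintype.card_fin]
    omega
  simp only [habs, Finset.sum_const, nsmul_eq_mul]
  exact mul_lt_mul_of_pos_right (by exact_mod_cast hcard) (abs_pos.mpr hk)

lemma two_mul_lt_of_nullspaceProperty_signlessInc {n : ℕ} {G : SimpleGraph (Fin n)}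
    (hn : 0 < n) (hbip : IsBipartite G) {s : ℕ}
    (h : NullspaceProperty (signlessInc n G) s) : 2 * s < n := by
  obtain ⟨x, hx, habs⟩ := hbip.exists_abs_eq_one
  have hx0 : x ≠ 0 := fun h0 => by simpa [h0] using habs ⟨0, hn⟩
  obtain ⟨S, -, hS⟩ := Finset.exists_subset_card_eq
    (s := (Finset.univ : Finset (Fin n))) (n := min s n) (by simp)
  have hlt := h x hx0 hx S (by omega)
  simp only [habs, Finset.sum_const, nsmul_eq_mul, mul_one, Nat.cast_lt, Finset.card_compl,
    Fintype.card_fin] at hlt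
  omega

/-- for a bipartite graph `G`, the signless incidence matrix `R` satisfies
the nullspace property of order `s` (for positive `s`) iff `2s < n`; in particular it
satisfies the nullspace property of order `⌊(n-1)/2⌋`. -/
theorem stmt17 {n : ℕ} (hn : 2 ≤ n) (G : SimpleGraph (Fin n)) (hconn : G.Connected)
    (hbip : IsBipartite G) :
    (∀ s : ℕ, 0 < s → (NullspaceProperty (signlessInc n G) s ↔ 2 * s < n)) ∧
      NullspaceProperty (signlessInc n G) ((n - 1) / 2) := by
  exact ⟨fun s _ => ⟨two_mul_lt_of_nullspaceProperty_signlessInc (by omega) hbip,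
    nullspaceProperty_signlessInc_of_two_mul_lt hconn⟩,
    nullspaceProperty_signlessInc_of_two_mul_lt hconn (by omega)⟩
end
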